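/- arXiv:2508.02065 — 2 statements merged into one kernel-verified Lean document; each statement's English description precedes it below -/
import Mathlib

section
/- Let V be a real vector space with symmetric bilinear forms a and b, where a is positive semidefinite and b is positive semidefinite. Suppose u ∈ V and γ ∈ ℝ satisfy b(u,u) = 1 and a(u,v) = γ·b(u,v) for every v ∈ V. Assume the discrete Poincaré inequality: there is a constant C_P > 0 with b(v,v) ≤ C_P·a(v,v) for all v ∈ V. Let w ∈ V satisfy b(w,w) ≥ c₀ for some constant c₀ > 0, and set γ̃ = a(w,w)/b(w,w). Then |γ̃ − γ| ≤ ((1 + |γ|·C_P)/c₀) · a(w−u, w−u). -/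
/-- Abstract form of Lemma 4.2: Rayleigh quotient error bound. -/
theorem rayleigh_quotient_error_bound {V : Type*} [AddCommGroup V] [Module ℝ V]
    (a b : V →ₗ[ℝ] V →ₗ[ℝ] ℝ)
    (ha_symm : ∀ x y : V, a x y = a y x)
    (hb_symm : ∀ x y : V, b x y = b y x)
    (ha_pos : ∀ x : V, 0 ≤ a x x)
    (hb_pos : ∀ x : V, 0 ≤ b x x)
    (u : V) (γ : ℝ)
    (hnorm : b u u = 1)
    (heig : ∀ v : V, a u v = γ * b u v)
    (C_P : ℝ) (hCP : 0 < C_P)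
    (hPoincare : ∀ v : V, b v v ≤ C_P * a v v)
    (w : V) (c₀ : ℝ) (hc₀ : 0 < c₀) (hw : b w w ≥ c₀)
    (γt : ℝ) (hγt : γt = a w w / b w w) :
    |γt - γ| ≤ ((1 + |γ| * C_P) / c₀) * a (w - u) (w - u) := by
  have hB : 0 < b w w := hc₀.trans_le hw
  have key : (γt - γ) * b w w = a (w - u) (w - u) - γ * b (w - u) (w - u) := by
    have h₁ : (γt - γ) * b w w = a w w - γ * b w w := by
      rw [hγt]
      field_simp
    rw [h₁]
    simp only [map_sub, LinearMap.sub_apply]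
    rw [ha_symm w u, hb_symm w u, heig w, heig u]
    ring
  have hA := ha_pos (w - u)
  have hnum : |γt - γ| * b w w ≤ (1 + |γ| * C_P) * a (w - u) (w - u) := by
    calc |γt - γ| * b w w = |a (w - u) (w - u) - γ * b (w - u) (w - u)| := by
          rw [← key, abs_mul, abs_of_pos hB]
      _ ≤ |a (w - u) (w - u)| + |γ * b (w - u) (w - u)| := abs_sub _ _
      _ = a (w - u) (w - u) + |γ| * b (w - u) (w - u) := by
          rw [abs_mul, abs_of_nonneg hA, abs_of_nonneg (hb_pos _)]
      _ ≤ a (w - u) (w - u) + |γ| * (C_P * a (w - u) (w - u)) := by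
          gcongr
          exact hPoincare _
      _ = (1 + |γ| * C_P) * a (w - u) (w - u) := by ring
  rw [div_mul_eq_mul_div, le_div_iff₀ hc₀]
  exact (mul_le_mul_of_nonneg_left hw (abs_nonneg _)).trans hnum
end

section
/- Let V be a real vector space equipped with two symmetric bilinear forms a and m, let W be a real inner product space with inner product ⟪·,·⟫, and let b : V × W → ℝ be bilinear. Let u, u_h, Iu ∈ V, p, p_h ∈ W, and γ, γ_h ∈ ℝ. Assume: (i) a(u,u) + ⟪p,p⟫ = γ; (ii) a(u_h,u_h) + ⟪p_h,p_h⟫ = γ_h; (iii) m(u,u) = 1 and m(u_h,u_h) = 1; (iv) a(u_h, Iu) + b(Iu, p_h) = γ_h·m(u_h, Iu); (v) b(u, p_h) = ⟪p, p_h⟫; (vi) a(u − Iu, u_h) = 0; (vii) b(Iu − u, p_h) = 0. Then γ − γ_h = a(u−u_h, u−u_h) + ⟪p−p_h, p−p_h⟫ − γ_h·m(Iu−u_h, Iu−u_h) + γ_h·( m(Iu,Iu) − m(u,u) ). -/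
open scoped RealInnerProductSpace

/-- Abstract form of Theorem 5.5: eigenvalue error expansion for the ECR mixed scheme. -/
theorem ecr_eigenvalue_expansion {V W : Type*} [AddCommGroup V] [Module ℝ V]
    [NormedAddCommGroup W] [InnerProductSpace ℝ W]
    (a m : V →ₗ[ℝ] V →ₗ[ℝ] ℝ)
    (ha_symm : ∀ x y : V, a x y = a y x)
    (hm_symm : ∀ x y : V, m x y = m y x)
    (b : V →ₗ[ℝ] W →ₗ[ℝ] ℝ)
    (u uh Iu : V) (p ph : W) (γ γh : ℝ)
    (h1 : a u u + ⟪p, p⟫ = γ)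
    (h2 : a uh uh + ⟪ph, ph⟫ = γh)
    (h3 : m u u = 1) (h3' : m uh uh = 1)
    (h4 : a uh Iu + b Iu ph = γh * m uh Iu)
    (h5 : b u ph = ⟪p, ph⟫)
    (h6 : a (u - Iu) uh = 0)
    (h7 : b (Iu - u) ph = 0) :
    γ - γh = a (u - uh) (u - uh) + ⟪p - ph, p - ph⟫
      - γh * m (Iu - uh) (Iu - uh) + γh * (m Iu Iu - m u u) := by
  simp only [map_sub, LinearMap.sub_apply] at h6 h7 ⊢
  rw [inner_sub_left, inner_sub_right, inner_sub_right, real_inner_comm p ph,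
    ha_symm u uh, hm_symm Iu uh]
  rw [ha_symm u uh, ha_symm Iu uh] at h6
  linear_combination -h1 - h2 + γh * h3 + γh * h3' + 2 * (h4 + h6 - h5 - h7)
end
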